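/- arXiv:math/0607263 — 2 statements merged into one kernel-verified Lean document; each statement's English description precedes it below -/
import Mathlib

section
/- For every M-bimodule L and all ξ₁, ξ₂ ∈ L, the rank is subadditive: [ξ₁ + ξ₂] ≤ [ξ₁] + [ξ₂]. -/
/- Common setup: a von Neumann algebra `M` acting on a complex Hilbert space `H`,
a positive faithful normal unital trace `τ`, the algebraic tensor product
`A := M ⊗[ℂ] Mᵐᵒᵖ`, bimodules as left `A`-modules and the rank `[ξ]` of an element. -/

set_option maxHeartbeats 1000000
set_option synthInstance.maxHeartbeats 1000000

noncomputable section

open scoped TensorProduct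

namespace RankCompletion

variable {H : Type*} [NormedAddCommGroup H] [InnerProductSpace ℂ H] [CompleteSpace H]

instance : SMulMemClass (VonNeumannAlgebra H) ℂ (H →L[ℂ] H) where
  smul_mem {s} c a ha := by simpa using s.toStarSubalgebra.smul_mem ha c

/-- `p` is a projection in the von Neumann algebra `M`: `p = p*` and `p² = p`. -/
def IsProj (M : VonNeumannAlgebra H) (p : M) : Prop :=
  star p = p ∧ p * p = p

/-- `τ` is a unital, tracial, positive, faithful and normal ℂ-linear functional on `M`. -/
structure IsFiniteTrace (M : VonNeumannAlgebra H) (τ : M →ₗ[ℂ] ℂ) : Prop where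
  unital : τ 1 = 1
  tracial : ∀ x y : M, τ (x * y) = τ (y * x)
  pos_re : ∀ x : M, 0 ≤ (τ (star x * x)).re
  pos_im : ∀ x : M, (τ (star x * x)).im = 0
  faithful : ∀ x : M, τ (star x * x) = 0 → x = 0
  normal : ∀ (p : ℕ → M) (q : M), (∀ n, IsProj M (p n)) → IsProj M q →
    (∀ i j, i ≠ j → p i * p j = 0) →
    (∀ v : H, Filter.Tendsto
        (fun n => (((∑ k ∈ Finset.range n, p k : M) : H →L[ℂ] H)) v)
        Filter.atTop (nhds ((q : H →L[ℂ] H) v))) →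
    (τ q).re = ∑' n, (τ (p n)).re

/-- The algebraic tensor product `A = M ⊗_ℂ Mᵐᵒᵖ`; an `M`-bimodule is a left `A`-module. -/
abbrev BimodRing (M : VonNeumannAlgebra H) : Type _ := (↥M) ⊗[ℂ] (↥M)ᵐᵒᵖ

/-- The rank `[ξ]` of an element `ξ` of an `M`-bimodule `L`:
the infimum of `re τ(p) + re τ(q)` over projections `p q` with `((1-p) ⊗ (1-q)ᵒᵖ) • ξ = 0`. -/
def rank (M : VonNeumannAlgebra H) (τ : M →ₗ[ℂ] ℂ) {L : Type*} [AddCommGroup L]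
    [Module (BimodRing M) L] (ξ : L) : ℝ :=
  sInf { r : ℝ | ∃ p q : M, IsProj M p ∧ IsProj M q ∧
    (((1 - p) ⊗ₜ[ℂ] (MulOpposite.op (1 - q)) : BimodRing M)) • ξ = 0 ∧
    r = (τ p).re + (τ q).re }

open ContinuousLinearMap in
/-- Operators agreeing on the range and on the kernel of a self-adjoint operator are equal. -/
theorem eq_of_mul_eq_of_ker {A f g : H →L[ℂ] H} (hA : star A = A) (h : f * A = g * A)
    (hker : ∀ w, A w = 0 → f w = g w) : f = g := by
  set K := A.range.topologicalClosure
  have hK : K ≤ (f - g).ker := by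
    refine Submodule.topologicalClosure_minimal _ ?_ (f - g).isClosed_ker
    rintro _ ⟨v, rfl⟩
    have := congr($h v)
    simpa [sub_eq_zero] using! this
  have hK' : Kᗮ ≤ (f - g).ker := by
    intro w hw
    rw [Submodule.orthogonal_closure, orthogonal_range, ← star_eq_adjoint, hA] at hw
    simpa [sub_eq_zero] using! hker w hw
  have htop : K ⊔ Kᗮ = ⊤ := Submodule.sup_orthogonal_of_hasOrthogonalProjection
  ext v
  have : v ∈ (f - g).ker := sup_le hK hK' (htop ▸ Submodule.mem_top)
  simpa [sub_eq_zero] using! this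

open ContinuousLinearMap in
theorem norm_apply_eq_of_star_mul_self_eq {A x : H →L[ℂ] H} (h : star A * A = star x * x) (v : H) :
    ‖A v‖ = ‖x v‖ := by
  have : ‖A v‖ ^ 2 = ‖x v‖ ^ 2 := by
    rw [apply_norm_sq_eq_inner_adjoint_left, apply_norm_sq_eq_inner_adjoint_left]
    exact congr(RCLike.re (inner ℂ ($h v) v))
  exact (sq_eq_sq₀ (norm_nonneg _) (norm_nonneg _)).1 this

open ContinuousLinearMap in
/-- If `A` is self-adjoint with `A² = x* x`, then `x = u A` for some `u` vanishing on `ker A`. -/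
theorem exists_mul_eq_of_star_mul_self_eq {A x : H →L[ℂ] H} (hA : star A = A)
    (h : star A * A = star x * x) :
    ∃ u : H →L[ℂ] H, u * A = x ∧ ∀ w, A w = 0 → u w = 0 := by
  let K := A.range.topologicalClosure
  have hmem : ∀ v, A v ∈ K := fun v => A.range.le_topologicalClosure ⟨v, rfl⟩
  let e : H →ₗ[ℂ] K := (A : H →ₗ[ℂ] H).codRestrict K hmem
  have hdense : DenseRange e := by
    intro y
    rw [Topology.IsInducing.subtypeVal.closure_eq_preimage_closure_image, ← Set.range_comp]
    exact y.2
  have hnorm : ∃ C : ℝ, ∀ v, ‖(x : H →ₗ[ℂ] H) v‖ ≤ C * ‖e v‖ :=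
    ⟨1, fun v => by simpa [e] using (norm_apply_eq_of_star_mul_self_eq h v).ge⟩
  refine ⟨(LinearMap.extendOfNorm (x : H →ₗ[ℂ] H) e) ∘L K.orthogonalProjectionOnto, ?_, ?_⟩
  · ext v
    have : K.orthogonalProjectionOnto (A v) = e v :=
      Submodule.orthogonalProjectionOnto_mem_subspace_eq_self (e v)
    change LinearMap.extendOfNorm (x : H →ₗ[ℂ] H) e (K.orthogonalProjectionOnto (A v)) = x v
    rw [this, LinearMap.extendOfNorm_eq hdense hnorm]
    rfl
  · intro w hw
    have hw' : w ∈ Kᗮ := by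
      rw [Submodule.orthogonal_closure, orthogonal_range, ← star_eq_adjoint, hA]
      exact hw
    simp [Submodule.orthogonalProjectionOnto_apply_of_mem_orthogonal hw']

/-- Polar decomposition inside a von Neumann algebra: every `x` admits a partial isometry `u`
with the same left and right annihilators, such that `u u*` fixes `x`. -/
theorem exists_partial_isometry (M : VonNeumannAlgebra H) (x : M) :
    ∃ u : M, u * star u * u = u ∧ u * star u * x = x ∧
      (∀ y, y * x = 0 → y * u = 0) ∧ ∀ y, x * y = 0 → u * y = 0 := by
  obtain ⟨x, hx⟩ := x
  let A : H →L[ℂ] H := CFC.abs x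
  have hA : star A = A := (CFC.abs_nonneg x).isSelfAdjoint
  have hAA : A * A = star x * x := CFC.abs_mul_abs x
  have hsq : star A * A = star x * x := by rw [hA, hAA]
  obtain ⟨u, hu, hker⟩ := exists_mul_eq_of_star_mul_self_eq hA hsq
  have hxA : ∀ w, A w = 0 ↔ x w = 0 := fun w => by
    rw [← norm_eq_zero, norm_apply_eq_of_star_mul_self_eq hsq, norm_eq_zero]
  have hcomm : ∀ y ∈ M.commutant, Commute y x := fun y hy =>
    ((VonNeumannAlgebra.mem_commutant_iff.1 hy) x hx).symm
  have hcommA : ∀ y ∈ M.commutant, A * y = y * A := by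
    intro y hy
    exact (hcomm y hy).symm.cfcAbs_left (hcomm (star y) (star_mem hy)).symm
  have huM : u ∈ M := by
    rw [← M.commutant_commutant, VonNeumannAlgebra.mem_commutant_iff]
    intro y hy
    refine eq_of_mul_eq_of_ker hA ?_ fun w hw => ?_
    · rw [mul_assoc, mul_assoc, hu, ← hcommA y hy, ← mul_assoc, hu]
      exact hcomm y hy
    · have h₁ : A (y w) = 0 := by
        have := congr($(hcommA y hy) w)
        simpa [hw] using! this
      change y (u w) = u (y w)
      rw [hker w hw, hker _ h₁, map_zero]
  have hAu : A * (star u * u) = A := by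
    refine eq_of_mul_eq_of_ker hA ?_ fun w hw => ?_
    · calc A * (star u * u) * A = star (u * A) * (u * A) := by
            rw [star_mul, hA]; simp only [mul_assoc]
        _ = A * A := by rw [hu, hAA]
    · change A (star u (u w)) = A w
      rw [hker w hw, hw, map_zero, map_zero]
  have huA : star u * u * A = A := by
    have := congrArg star hAu
    rwa [star_mul, star_mul, star_star, hA] at this
  have huuu : u * star u * u = u := by
    refine eq_of_mul_eq_of_ker hA ?_ fun w hw => ?_
    · rw [mul_assoc u, mul_assoc u, huA]
    · change u (star u (u w)) = u w
      rw [hker w hw, map_zero, map_zero]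
  refine ⟨⟨u, huM⟩, Subtype.ext huuu, Subtype.ext ?_, fun y hy => Subtype.ext ?_,
    fun y hy => Subtype.ext ?_⟩
  · change u * star u * x = x
    rw [← hu, ← mul_assoc, huuu]
  · have hy' : (y : H →L[ℂ] H) * x = 0 := congrArg Subtype.val hy
    change (y : H →L[ℂ] H) * u = 0
    refine eq_of_mul_eq_of_ker hA ?_ fun w hw => ?_
    · rw [mul_assoc, hu, hy', zero_mul]
    · change (y : H →L[ℂ] H) (u w) = 0
      rw [hker w hw, map_zero]
  · have hy' : x * (y : H →L[ℂ] H) = 0 := congrArg Subtype.val hy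
    change u * (y : H →L[ℂ] H) = 0
    ext v
    exact hker _ ((hxA _).2 congr($hy' v))

theorem IsProj.re_trace_nonneg {M : VonNeumannAlgebra H} {τ : M →ₗ[ℂ] ℂ}
    (hτ : IsFiniteTrace M τ) {p : M} (hp : IsProj M p) : 0 ≤ (τ p).re := by
  have := hτ.pos_re p
  rwa [hp.1, hp.2] at this

/-- Two projections have a common upper bound of trace at most the sum of their traces. -/
theorem exists_isProj_trace_le {M : VonNeumannAlgebra H} {τ : M →ₗ[ℂ] ℂ}
    (hτ : IsFiniteTrace M τ) {p₁ p₂ : M} (h₁ : IsProj M p₁) (h₂ : IsProj M p₂) :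
    ∃ p, IsProj M p ∧ p * p₁ = p₁ ∧ p * p₂ = p₂ ∧ (τ p).re ≤ (τ p₁).re + (τ p₂).re := by
  obtain ⟨u, huuu, hux, hl, hr⟩ := exists_partial_isometry M ((1 - p₂) * p₁)
  have hu₂ : p₂ * u = 0 := hl _ (by rw [← mul_assoc, mul_sub, mul_one, h₂.2, sub_self, zero_mul])
  have hu₁ : u * p₁ = u := by
    have := hr (1 - p₁) (by rw [mul_assoc, mul_sub, mul_one, h₁.2, sub_self, mul_zero])
    rw [mul_sub, mul_one, sub_eq_zero] at this
    exact this.symm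
  have hu₂' : star u * p₂ = 0 := by
    simpa [h₂.1] using congrArg star hu₂
  have hu₁' : p₁ * star u = star u := by
    simpa [h₁.1] using congrArg star hu₁
  have hd : IsProj M (p₁ - star u * u) := by
    constructor
    · rw [star_sub, star_mul, star_star, h₁.1]
    · have e₁ : p₁ * (star u * u) = star u * u := by rw [← mul_assoc, hu₁']
      have e₂ : star u * u * p₁ = star u * u := by rw [mul_assoc, hu₁]
      have e₃ : star u * u * (star u * u) = star u * u := by
        rw [mul_assoc, ← mul_assoc u, huuu]
      rw [sub_mul, mul_sub, mul_sub, h₁.2, e₁, e₂, e₃, sub_self, sub_zero]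
  have e₁ : p₂ * (u * star u) = 0 := by rw [← mul_assoc, hu₂, zero_mul]
  have e₂ : u * star u * p₂ = 0 := by rw [mul_assoc, hu₂', mul_zero]
  have e₃ : u * star u * (u * star u) = u * star u := by rw [← mul_assoc, huuu]
  refine ⟨p₂ + u * star u, ⟨?_, ?_⟩, ?_, ?_, ?_⟩
  · rw [star_add, star_mul, star_star, h₂.1]
  · rw [add_mul, mul_add, mul_add, h₂.2, e₁, e₂, e₃, add_zero, zero_add]
  · have : u * star u * p₁ = (1 - p₂) * p₁ := by
      conv_rhs => rw [← hux, ← mul_assoc, mul_sub, e₂, mul_one, sub_zero]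
    rw [add_mul, this, sub_mul, one_mul, add_sub_cancel]
  · rw [add_mul, h₂.2, e₂, add_zero]
  · have := hd.re_trace_nonneg hτ
    rw [map_sub, hτ.tracial, Complex.sub_re] at this
    rw [map_add, Complex.add_re]
    linarith

theorem one_sub_mul_one_sub {R : Type*} [Ring R] {p q : R} (h : p * q = q) :
    (1 - p) * (1 - q) = 1 - p := by
  rw [mul_sub, mul_one, sub_mul, one_mul, h, sub_self, sub_zero]

theorem IsProj.mul_eq_symm {M : VonNeumannAlgebra H} {p q : M} (hp : IsProj M p)
    (hq : IsProj M q) (h : p * q = q) : q * p = q := by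
  simpa [hp.1, hq.1] using congrArg star h

theorem smul_eq_zero_of_eq_mul {R L : Type*} [Semiring R] [AddCommGroup L] [Module R L]
    {a b c : R} {ξ : L} (h : a = b * c) (hc : c • ξ = 0) : a • ξ = 0 := by
  rw [h, mul_smul, hc, smul_zero]

/-- Enlarging the two projections preserves annihilation of `ξ`. -/
theorem tmul_smul_eq_zero {M : VonNeumannAlgebra H} {L : Type*} [AddCommGroup L]
    [Module (BimodRing M) L] {ξ : L} {p q p' q' : M} (hp : p' * p = p) (hq : q * q' = q)
    (h : (((1 - p) ⊗ₜ[ℂ] (MulOpposite.op (1 - q)) : BimodRing M)) • ξ = 0) :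
    (((1 - p') ⊗ₜ[ℂ] (MulOpposite.op (1 - q')) : BimodRing M)) • ξ = 0 := by
  have hq' : (1 - q) * (1 - q') = 1 - q' := by
    rw [mul_sub, mul_one, sub_mul, one_mul, hq]
    abel
  have : (((1 - p') ⊗ₜ[ℂ] (MulOpposite.op (1 - q')) : BimodRing M)) =
      ((1 - p') ⊗ₜ[ℂ] (MulOpposite.op (1 - q')) : BimodRing M) *
        ((1 - p) ⊗ₜ[ℂ] (MulOpposite.op (1 - q)) : BimodRing M) := by
    rw [Algebra.TensorProduct.tmul_mul_tmul, ← MulOpposite.op_mul, hq', one_sub_mul_one_sub hp]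
  exact smul_eq_zero_of_eq_mul this h

/-- Subadditivity of the rank: `[ξ₁ + ξ₂] ≤ [ξ₁] + [ξ₂]`. -/
theorem rank_add_le (M : VonNeumannAlgebra H) (τ : M →ₗ[ℂ] ℂ) (hτ : IsFiniteTrace M τ)
    {L : Type*} [AddCommGroup L] [Module (BimodRing M) L] (ξ₁ ξ₂ : L) :
    rank M τ (ξ₁ + ξ₂) ≤ rank M τ ξ₁ + rank M τ ξ₂ := by
  have hbdd : ∀ ξ : L, BddBelow { r : ℝ | ∃ p q : M, IsProj M p ∧ IsProj M q ∧
      (((1 - p) ⊗ₜ[ℂ] (MulOpposite.op (1 - q)) : BimodRing M)) • ξ = 0 ∧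
      r = (τ p).re + (τ q).re } := by
    rintro ξ
    refine ⟨0, ?_⟩
    rintro _ ⟨p, q, hp, hq, -, rfl⟩
    exact add_nonneg (hp.re_trace_nonneg hτ) (hq.re_trace_nonneg hτ)
  have hne : ∀ ξ : L, { r : ℝ | ∃ p q : M, IsProj M p ∧ IsProj M q ∧
      (((1 - p) ⊗ₜ[ℂ] (MulOpposite.op (1 - q)) : BimodRing M)) • ξ = 0 ∧
      r = (τ p).re + (τ q).re }.Nonempty := fun ξ =>
    ⟨_, 1, 1, ⟨star_one _, one_mul _⟩, ⟨star_one _, one_mul _⟩,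
      by rw [sub_self, TensorProduct.zero_tmul]; exact Module.zero_smul ξ, rfl⟩
  refine le_of_forall_pos_le_add fun ε hε => ?_
  obtain ⟨_, ⟨p₁, q₁, hp₁, hq₁, hξ₁, rfl⟩, hlt₁⟩ :=
    Real.lt_sInf_add_pos (hne ξ₁) (half_pos hε)
  obtain ⟨_, ⟨p₂, q₂, hp₂, hq₂, hξ₂, rfl⟩, hlt₂⟩ :=
    Real.lt_sInf_add_pos (hne ξ₂) (half_pos hε)
  obtain ⟨p, hp, hpp₁, hpp₂, hpτ⟩ := exists_isProj_trace_le hτ hp₁ hp₂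
  obtain ⟨q, hq, hqq₁, hqq₂, hqτ⟩ := exists_isProj_trace_le hτ hq₁ hq₂
  have hle : rank M τ (ξ₁ + ξ₂) ≤ (τ p).re + (τ q).re := by
    refine csInf_le (hbdd _) ⟨p, q, hp, hq, ?_, rfl⟩
    rw [smul_add, tmul_smul_eq_zero hpp₁ (hq.mul_eq_symm hq₁ hqq₁) hξ₁,
      tmul_smul_eq_zero hpp₂ (hq.mul_eq_symm hq₂ hqq₂) hξ₂, add_zero]
  change _ < rank M τ ξ₁ + ε / 2 at hlt₁
  change _ < rank M τ ξ₂ + ε / 2 at hlt₂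
  linarith

end RankCompletion
end
end

section
/- Regard M itself as an M-bimodule via (a ⊗ bᵒᵖ) • x = a·x·b. Let x ∈ M and let e be a support projection of x, i.e. a projection e ∈ M with x·e = x and such that e·f = e for every projection f ∈ M satisfying x·f = x. Then the rank of x in this bimodule equals the trace of the support projection: [x] = re τ(e). -/
/- Common setup: a von Neumann algebra `M` acting on a complex Hilbert space `H`,
a positive faithful normal unital trace `τ`, the algebraic tensor product
`A := M ⊗[ℂ] Mᵐᵒᵖ`, bimodules as left `A`-modules and the rank `[ξ]` of an element. -/

set_option maxHeartbeats 1000000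
set_option synthInstance.maxHeartbeats 1000000

noncomputable section

open scoped TensorProduct

namespace RankCompletion

variable {H : Type*} [NormedAddCommGroup H] [InnerProductSpace ℂ H] [CompleteSpace H]

/-- `M` itself as an `M`-bimodule, via `(a ⊗ bᵒᵖ) • x = a * x * b`. -/
instance selfModule (M : VonNeumannAlgebra H) : Module (BimodRing M) (↥M) :=
  TensorProduct.Algebra.module

lemma selfModule_smul_def (M : VonNeumannAlgebra H) (a b x : M) :
    ((a ⊗ₜ[ℂ] MulOpposite.op b : BimodRing M)) • x = a * x * b := by
  rw [TensorProduct.Algebra.smul_def]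
  simp [MulOpposite.smul_eq_mul_unop, smul_eq_mul, mul_assoc]

open ContinuousLinearMap in
/-- An operator that vanishes on the range and on the kernel of a self-adjoint operator is zero. -/
lemma eq_zero_of_mul_eq_zero_of_ker_le {a s : H →L[ℂ] H} (ha : IsSelfAdjoint a)
    (hsa : s * a = 0) (hker : ∀ v, a v = 0 → s v = 0) : s = 0 := by
  have hrange : a.range.topologicalClosure ≤ s.ker := by
    refine Submodule.topologicalClosure_minimal _ ?_ s.isClosed_ker
    rintro _ ⟨w, rfl⟩
    exact congr($hsa w)
  ext v
  obtain ⟨b, hb, c, hc, rfl⟩ := a.range.topologicalClosure.exists_add_mem_mem_orthogonal v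
  have hc' : a c = 0 := by
    rw [Submodule.orthogonal_closure, orthogonal_range, ha.adjoint_eq] at hc
    exact hc
  have hb' : s b = 0 := hrange hb
  simp [hb', hker c hc']

lemma norm_cfcAbs_apply (y : H →L[ℂ] H) (v : H) : ‖CFC.abs y v‖ = ‖y v‖ := by
  have ha : IsSelfAdjoint (CFC.abs y) := .of_nonneg (CFC.abs_nonneg y)
  have h : inner ℂ (CFC.abs y v) (CFC.abs y v) = inner ℂ (y v) (y v) := by
    rw [← ContinuousLinearMap.adjoint_inner_right, ha.adjoint_eq,
      ← ContinuousLinearMap.adjoint_inner_right]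
    exact congr(inner ℂ v ($(CFC.abs_mul_abs y) v))
  rw [inner_self_eq_norm_sq_to_K, inner_self_eq_norm_sq_to_K] at h
  exact (sq_eq_sq₀ (norm_nonneg _) (norm_nonneg _)).mp (by exact_mod_cast h)

/-- Polar decomposition: `y = u|y|` for a partial isometry `u` with the same kernel as `y`. -/
lemma exists_polar_decomposition (y : H →L[ℂ] H) :
    ∃ u : H →L[ℂ] H, u * CFC.abs y = y ∧ u * (star u * u) = u ∧ ∀ v, u v = 0 ↔ y v = 0 := by
  set a := CFC.abs y
  have ha : IsSelfAdjoint a := .of_nonneg (CFC.abs_nonneg y)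
  have hnorm : ∀ v, ‖a v‖ = ‖y v‖ := norm_cfcAbs_apply y
  let K := a.range.topologicalClosure
  have hmem : ∀ v, a v ∈ K := fun v => Submodule.le_topologicalClosure _ ⟨v, rfl⟩
  let i : H →ₗ[ℂ] K := (a : H →ₗ[ℂ] H).codRestrict K hmem
  have hi : DenseRange i := by
    intro z
    rw [closure_subtype]
    refine closure_mono ?_ z.2
    rintro _ ⟨v, rfl⟩
    exact ⟨i v, ⟨v, rfl⟩, rfl⟩
  let V : K →L[ℂ] H := (y : H →ₗ[ℂ] H).extendOfNorm i
  have hVi : ∀ v, V (i v) = y v :=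
    LinearMap.extendOfNorm_eq hi ⟨1, fun v => by rw [one_mul]; exact (hnorm v).ge⟩
  have hV : ∀ z, ‖V z‖ = ‖z‖ := by
    refine hi.induction ?_ (isClosed_eq (by fun_prop) (by fun_prop))
    rintro _ ⟨v, rfl⟩
    rw [hVi]
    exact (hnorm v).symm
  let P : H →L[ℂ] K := K.orthogonalProjectionOnto
  have hker : ∀ v, V (P v) = 0 ↔ y v = 0 := by
    intro v
    rw [← norm_eq_zero, hV, norm_eq_zero, ← norm_eq_zero (a := y v), ← hnorm, norm_eq_zero,
      Submodule.orthogonalProjectionOnto_eq_zero_iff, Submodule.orthogonal_closure,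
      ContinuousLinearMap.orthogonal_range, ha.adjoint_eq]
    rfl
  refine ⟨V ∘L P, ?_, ?_, hker⟩
  · ext v
    have hP : P (a v) = i v := Submodule.orthogonalProjectionOnto_mem_subspace_eq_self (i v)
    change V (P (a v)) = y v
    rw [hP, hVi]
  · have hVV : V.adjoint ∘L V = 1 := (ContinuousLinearMap.norm_map_iff_adjoint_comp_self V).mp hV
    have hPadj : P.adjoint = K.subtypeL := K.adjoint_orthogonalProjectionOnto
    change (V ∘L P) ∘L ((V ∘L P).adjoint ∘L (V ∘L P)) = V ∘L P
    rw [ContinuousLinearMap.adjoint_comp]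
    ext v
    have h₁ : ∀ z, V.adjoint (V z) = z := fun z => congr($hVV z)
    have h₂ : ∀ z, P (P.adjoint z) = z := fun z => by
      rw [hPadj]
      exact Submodule.orthogonalProjectionOnto_mem_subspace_eq_self z
    simp [h₁, h₂]

/-- A partial isometry in `M` whose support is the right support of `y`, and which inherits
from `y` any left unit in `M`. -/
lemma exists_partialIsometry (M : VonNeumannAlgebra H) (y : M) :
    ∃ u : M, u * (star u * u) = u ∧ y * (star u * u) = y ∧
      (∀ p : M, p * y = y → p * u = u) ∧ (∀ q : M, y * q = 0 → u * q = 0) := by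
  obtain ⟨u, hua, huu, hker⟩ := exists_polar_decomposition (y : H →L[ℂ] H)
  have ha : IsSelfAdjoint (CFC.abs (y : H →L[ℂ] H)) := .of_nonneg (CFC.abs_nonneg _)
  have hker' : ∀ v, CFC.abs (y : H →L[ℂ] H) v = 0 ↔ u v = 0 := fun v => by
    rw [hker, ← norm_eq_zero, norm_cfcAbs_apply, norm_eq_zero]
  have hu : u ∈ M := by
    rw [← VonNeumannAlgebra.commutant_commutant M, VonNeumannAlgebra.mem_commutant_iff]
    intro c hc
    have hcy := VonNeumannAlgebra.mem_commutant_iff.mp hc _ y.2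
    have hcy' := VonNeumannAlgebra.mem_commutant_iff.mp (star_mem hc) _ y.2
    have hca : Commute c (CFC.abs (y : H →L[ℂ] H)) :=
      Commute.cfcAbs_right hcy hcy'
    rw [← sub_eq_zero]
    refine eq_zero_of_mul_eq_zero_of_ker_le ha ?_ fun v hv => ?_
    · rw [sub_mul, mul_assoc, hua, mul_assoc, hca.eq, ← mul_assoc, hua, hcy, sub_self]
    · have hcv : CFC.abs (y : H →L[ℂ] H) (c v) = 0 := by
        have h : c (CFC.abs (y : H →L[ℂ] H) v) = CFC.abs (y : H →L[ℂ] H) (c v) := congr($hca.eq v)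
        rw [← h, hv, map_zero]
      simp [(hker' _).mp hv, (hker' _).mp hcv]
  refine ⟨⟨u, hu⟩, Subtype.ext huu, Subtype.ext ?_, fun p hp => Subtype.ext ?_,
    fun q hq => Subtype.ext ?_⟩
  · ext v
    have h : (y : H →L[ℂ] H) (v - (star u * u) v) = 0 := by
      rw [← hker, map_sub, sub_eq_zero]
      exact congr($huu.symm v)
    rw [map_sub, sub_eq_zero] at h
    exact h.symm
  · have hp' : (p : H →L[ℂ] H) * y = y := congr(($hp : H →L[ℂ] H))
    change (p : H →L[ℂ] H) * u = u
    rw [← sub_eq_zero]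
    refine eq_zero_of_mul_eq_zero_of_ker_le ha ?_ fun v hv => ?_
    · rw [sub_mul, mul_assoc, hua, hp', sub_self]
    · simp [(hker' v).mp hv]
  · ext v
    have hq' : (y : H →L[ℂ] H) * q = 0 := congr(($hq : H →L[ℂ] H))
    exact (hker _).mpr congr($hq' v)

variable {M : VonNeumannAlgebra H} {τ : M →ₗ[ℂ] ℂ}

lemma IsFiniteTrace.re_nonneg_of_isProj (hτ : IsFiniteTrace M τ) {p : M} (hp : IsProj M p) :
    0 ≤ (τ p).re := by
  have h := hτ.pos_re p
  rwa [hp.1, hp.2] at h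

lemma IsFiniteTrace.re_mono_of_isProj (hτ : IsFiniteTrace M τ) {e f : M} (he : IsProj M e)
    (hf : IsProj M f) (hef : e * f = e) : (τ e).re ≤ (τ f).re := by
  have hfe : f * e = e := by simpa [he.1, hf.1] using congr(star $hef)
  have h := hτ.re_nonneg_of_isProj (p := f - e)
    ⟨by rw [star_sub, he.1, hf.1], by rw [mul_sub, sub_mul, sub_mul, he.2, hf.2, hef, hfe]; abel⟩
  rwa [map_sub, Complex.sub_re, sub_nonneg] at h

/-- The trace of the support projection of `x` is bounded by `τ p + τ q` as soon as
`(1 - p) * x * (1 - q) = 0`. -/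
lemma IsFiniteTrace.re_support_le (hτ : IsFiniteTrace M τ) {x e p q : M} (he : IsProj M e)
    (hmin : ∀ f : M, IsProj M f → x * f = x → e * f = e) (hp : IsProj M p) (hq : IsProj M q)
    (h : (1 - p) * x * (1 - q) = 0) : (τ e).re ≤ (τ p).re + (τ q).re := by
  obtain ⟨u, huu, hyu, hleft, hright⟩ := exists_partialIsometry M (x * (1 - q))
  have hpu : p * u = u := hleft p <| by
    rw [mul_assoc, sub_mul, one_mul, sub_eq_zero] at h
    exact h.symm
  have huq : u * q = 0 := hright q <| by rw [mul_assoc, sub_mul, one_mul, hq.2, sub_self, mul_zero]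
  have hqu : q * star u = 0 := by simpa [hq.1] using congr(star $huq)
  have hup : star u * p = star u := by simpa [hp.1] using congr(star $hpu)
  have hf : IsProj M (q + star u * u) := by
    refine ⟨by simp [hq.1], ?_⟩
    rw [mul_add, add_mul, add_mul, hq.2, mul_assoc (star u) u q, huq, mul_zero, add_zero,
      ← mul_assoc q, hqu, zero_mul, zero_add, mul_assoc (star u) u (star u * u), huu]
  have hxf : x * (q + star u * u) = x := by
    have h₁ : (1 - q) * (star u * u) = star u * u := by
      rw [sub_mul, one_mul, ← mul_assoc q, hqu, zero_mul, sub_zero]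
    rw [mul_assoc, h₁] at hyu
    rw [mul_add, hyu, mul_sub, mul_one, add_sub_cancel]
  have hl : IsProj M (u * star u) :=
    ⟨by simp, by rw [mul_assoc, ← mul_assoc (star u), ← mul_assoc u, huu]⟩
  calc (τ e).re ≤ (τ (q + star u * u)).re := hτ.re_mono_of_isProj he hf (hmin _ hf hxf)
    _ = (τ (u * star u)).re + (τ q).re := by
      rw [map_add, Complex.add_re, hτ.tracial (star u) u, add_comm]
    _ ≤ (τ p).re + (τ q).re :=
      add_le_add_left (hτ.re_mono_of_isProj hl hp (by rw [mul_assoc, hup])) _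

/-- For `x ∈ M`, regarded as an element of the bimodule `M`, the rank of `x`
equals the trace of its support projection. -/
theorem rank_eq_trace_support (M : VonNeumannAlgebra H) (τ : M →ₗ[ℂ] ℂ)
    (hτ : IsFiniteTrace M τ) (x e : M) (he : IsProj M e) (hxe : x * e = x)
    (hmin : ∀ f : M, IsProj M f → x * f = x → e * f = e) :
    rank M τ x = (τ e).re := by
  refine IsLeast.csInf_eq ⟨?_, ?_⟩
  · refine ⟨0, e, ⟨star_zero _, mul_zero _⟩, he, ?_, by simp⟩
    rw [selfModule_smul_def, sub_zero, one_mul, mul_sub, mul_one, hxe, sub_self]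
  · rintro _ ⟨p, q, hp, hq, h, rfl⟩
    rw [selfModule_smul_def] at h
    exact hτ.re_support_le he hmin hp hq h

end RankCompletion
end
end
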